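/- arXiv:2004.14741 — 3 statements merged into one kernel-verified Lean document; each statement's English description precedes it below -/
import Mathlib

section
/- For every k ≥ 2, n ≥ 1, and 0 < δ < 1, the maximum over pure strategy profiles a ∈ [k]^n of the total variation distance d_TV(e_1 + N(a^δ), e_2 + N(a^δ)) is at most P(S_n^{2δ/k} ∈ {0,1}), where (S_m^r) is the lazy symmetric random walk on ℤ with rate r. -/
open Finset

/-- `perturbW k δ a j` is the probability that the `δ`-perturbation of the pure
action `a ∈ [k]` plays the action `j`: with probability `1-δ` play `a`, with
probability `δ` play uniformly in `[k]`. -/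
noncomputable def perturbW (k : ℕ) (δ : ℝ) (a j : Fin k) : ℝ :=
  (1 - δ) * (if j = a then 1 else 0) + δ / k

/-- Probability that the (independent) `δ`-perturbation of the pure profile `a`
realises as the pure profile `b`. -/
noncomputable def profW (n k : ℕ) (δ : ℝ) (a b : Fin n → Fin k) : ℝ :=
  ∏ i, perturbW k δ (a i) (b i)

/-- A game: payoffs lie in `[0,1]`. -/
def IsGame (n k : ℕ) (g : (Fin n → Fin k) → Fin n → ℝ) : Prop :=
  ∀ a i, g a i ∈ Set.Icc (0 : ℝ) 1

/-- The number of players taking action `j` in the profile `a`. -/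
def actCount (n k : ℕ) (a : Fin n → Fin k) (j : Fin k) : ℕ :=
  (Finset.univ.filter fun i => a i = j).card

/-- A game is anonymous if each player's payoff depends only on his own action and
on the number of players taking each action. -/
def IsAnonymous (n k : ℕ) (g : (Fin n → Fin k) → Fin n → ℝ) : Prop :=
  ∀ (a b : Fin n → Fin k) (i : Fin n), a i = b i →
    (∀ j, actCount n k a j = actCount n k b j) → g a i = g b i

/-- The `δ`-perturbed game `g^δ`. -/
noncomputable def perturbGame (n k : ℕ) (δ : ℝ) (g : (Fin n → Fin k) → Fin n → ℝ) :
    (Fin n → Fin k) → Fin n → ℝ :=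
  fun a i => ∑ b : Fin n → Fin k, profW n k δ a b * g b i

/-- The Lipschitz constant of a game: the largest change of some player's payoff
when a single opponent changes his action. -/
noncomputable def lipC (n k : ℕ) (g : (Fin n → Fin k) → Fin n → ℝ) : ℝ :=
  sSup {x | ∃ (i : Fin n) (a b : Fin n → Fin k), a i = b i ∧
    (Finset.univ.filter fun j => a j ≠ b j).card = 1 ∧ x = |g a i - g b i|}

/-- The worst-case Lipschitz constant of `δ`-perturbed `n`-player `k`-action
anonymous games. -/
noncomputable def lam (n k : ℕ) (δ : ℝ) : ℝ :=
  sSup {x | ∃ g : (Fin n → Fin k) → Fin n → ℝ,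
    IsGame n k g ∧ IsAnonymous n k g ∧ x = lipC n k (perturbGame n k δ g)}
/-- `walk r m z` is the probability that the lazy symmetric random walk on `ℤ` with
rate `r` (i.i.d. increments: `0` w.p. `1-r`, `±1` w.p. `r/2` each), started at `0`,
is at `z` after `m` steps; i.e. `P(S_m^r = z)`. -/
noncomputable def walk (r : ℝ) : ℕ → ℤ → ℝ
  | 0, z => if z = 0 then 1 else 0
  | m + 1, z => (1 - r) * walk r m z + r / 2 * walk r m (z - 1) + r / 2 * walk r m (z + 1)
/-- The `j`-th standard basis vector of `ℤ^k`. -/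
def basisVec (k : ℕ) (j : Fin k) : Fin k → ℤ := fun j' => if j' = j then 1 else 0

/-- The vector counting how many players take each action in the profile `a`,
viewed in `ℤ^k`. -/
def countVec (n k : ℕ) (a : Fin n → Fin k) : Fin k → ℤ :=
  fun j => ((Finset.univ.filter fun i => a i = j).card : ℤ)

/-- `shiftCountDist n k δ a v x` is the probability `P(v + N(a^δ) = x)`, i.e. the
distribution of the action-count vector of the `δ`-perturbation of the profile `a`,
shifted by the vector `v ∈ ℤ^k`. -/
noncomputable def shiftCountDist (n k : ℕ) (δ : ℝ) (a : Fin n → Fin k)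
    (v : Fin k → ℤ) (x : Fin k → ℤ) : ℝ :=
  ∑ b : Fin n → Fin k, profW n k δ a b * (if v + countVec n k b = x then 1 else 0)

/-- The total variation distance between two distributions on `α`, given by their
probability mass functions: the supremum over events `A ⊆ α` of the discrepancy. -/
noncomputable def dTV {α : Type*} (P Q : α → ℝ) : ℝ :=
  sSup {x | ∃ A : Set α, x = |(∑' a : A, P a) - (∑' a : A, Q a)|}

/-- The expectation of `f (N(a^δ))`. -/
noncomputable def countExpect (n k : ℕ) (δ : ℝ) (a : Fin n → Fin k)
    (f : (Fin k → ℤ) → ℝ) : ℝ :=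
  ∑ b : Fin n → Fin k, profW n k δ a b * f (countVec n k b)

/-- The probability that the lazy symmetric walk is in `{1-d, …, d}` after `n` steps. By the
reflection principle, this is the probability that the walk started at `d` has not reached `0`. -/
noncomputable def walkWindow (r : ℝ) (n d : ℕ) : ℝ :=
  ∑ i ∈ range d, (walk r n ((i : ℤ) + 1) + walk r n (-(i : ℤ)))

lemma countVec_cons (n k : ℕ) (l : Fin k) (b : Fin n → Fin k) :
    countVec (n + 1) k (Fin.cons l b) = basisVec k l + countVec n k b := by
  funext j
  simp only [countVec, basisVec, Pi.add_apply, Finset.card_filter, Fin.sum_univ_succ,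
    Fin.cons_zero, Fin.cons_succ]
  push_cast
  simp [eq_comm]

lemma countExpect_succ (n k : ℕ) (δ : ℝ) (a : Fin (n + 1) → Fin k) (f : (Fin k → ℤ) → ℝ) :
    countExpect (n + 1) k δ a f =
      ∑ l, perturbW k δ (a 0) l *
        countExpect n k δ (fun i => a i.succ) (fun x => f (basisVec k l + x)) := by
  unfold countExpect
  rw [← (Fin.consEquiv (fun _ : Fin (n + 1) => Fin k)).sum_comp, Fintype.sum_prod_type]
  refine Finset.sum_congr rfl fun l _ => ?_
  rw [Finset.mul_sum]
  refine Finset.sum_congr rfl fun b _ => ?_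
  rw [show Fin.consEquiv (fun _ : Fin (n + 1) => Fin k) (l, b) = Fin.cons l b from rfl,
    countVec_cons]
  simp only [profW, Fin.prod_univ_succ, Fin.cons_zero,
    Fin.cons_succ, mul_assoc]

lemma sum_perturbW_mul (k : ℕ) (δ : ℝ) (a : Fin k) (g : Fin k → ℝ) :
    ∑ l, perturbW k δ a l * g l = (1 - δ) * g a + δ / k * ∑ l, g l := by
  simp [perturbW, add_mul, Finset.sum_add_distrib, Finset.mul_sum]

lemma walkWindow_zero_succ (r : ℝ) (d : ℕ) : walkWindow r 0 (d + 1) = 1 := by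
  induction d with
  | zero => simp [walkWindow, walk]
  | succ d ih =>
    rw [walkWindow, Finset.sum_range_succ, ← walkWindow, ih]
    have h₁ : ((d + 1 : ℕ) : ℤ) + 1 ≠ 0 := by omega
    have h₂ : -((d + 1 : ℕ) : ℤ) ≠ 0 := by omega
    simp only [walk, if_neg h₁, if_neg h₂, add_zero]

lemma sum_range_walk_neighbours (r : ℝ) (n d : ℕ) :
    ∑ i ∈ range (d + 1), (walk r n (i : ℤ) + walk r n ((i : ℤ) + 2)
      + walk r n (-(i : ℤ) - 1) + walk r n (-(i : ℤ) + 1))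
      = walkWindow r n (d + 2) + walkWindow r n d := by
  induction d with
  | zero =>
    simp [walkWindow, Finset.sum_range_succ]
    ring
  | succ d ih =>
    have hs : ∀ m, walkWindow r n (m + 1) =
        walkWindow r n m + (walk r n ((m : ℤ) + 1) + walk r n (-(m : ℤ))) :=
      fun m => Finset.sum_range_succ _ _
    rw [Finset.sum_range_succ, ih, hs (d + 2), hs d]
    push_cast
    rw [show (d : ℤ) + 1 + 2 = d + 2 + 1 by ring,
      show -((d : ℤ) + 1) - 1 = -(d + 2) by ring, show -((d : ℤ) + 1) + 1 = -d by ring]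
    ring

lemma walkWindow_succ_succ (r : ℝ) (n d : ℕ) :
    walkWindow r (n + 1) (d + 1) = (1 - r) * walkWindow r n (d + 1)
      + r / 2 * (walkWindow r n (d + 2) + walkWindow r n d) := by
  rw [← sum_range_walk_neighbours]
  unfold walkWindow
  rw [Finset.mul_sum, Finset.mul_sum, ← Finset.sum_add_distrib]
  refine Finset.sum_congr rfl fun i _ => ?_
  simp only [walk]
  rw [show (i : ℤ) + 1 - 1 = i by ring, show (i : ℤ) + 1 + 1 = i + 2 by ring]
  ring

/-- Pushing a test function along a reflection coupling of the counts started from `d • e_i` and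
`d • e_j`: their separation is a lazy symmetric walk, absorbed at `0`. -/
lemma countExpect_sub_le_walkWindow (k : ℕ) (hk : 2 ≤ k) (δ : ℝ) (hδ0 : 0 ≤ δ) (hδ1 : δ ≤ 1)
    (i j : Fin k) (hij : i ≠ j) (n : ℕ) (a : Fin n → Fin k) (d : ℕ) (f : (Fin k → ℤ) → ℝ)
    (hf : ∀ x, f x ∈ Set.Icc (0 : ℝ) 1) :
    countExpect n k δ a (fun x => f (d • basisVec k i + x))
      - countExpect n k δ a (fun x => f (d • basisVec k j + x)) ≤ walkWindow (2 * δ / k) n d := by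
  induction n generalizing d f with
  | zero =>
    cases d with
    | zero => simp [walkWindow]
    | succ d =>
      rw [walkWindow_zero_succ]
      simp only [countExpect, profW, Finset.univ_eq_empty, Finset.prod_empty, one_mul,
        Finset.univ_unique, Finset.sum_singleton]
      have h₁ := (hf ((d + 1) • basisVec k i + countVec 0 k default)).2
      have h₂ := (hf ((d + 1) • basisVec k j + countVec 0 k default)).1
      linarith
  | succ n ih =>
    cases d with
    | zero => simp [walkWindow]
    | succ d =>
      rw [walkWindow_succ_succ, countExpect_succ, countExpect_succ, sum_perturbW_mul,
        sum_perturbW_mul]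
      set a' : Fin n → Fin k := fun m => a m.succ
      set P : Fin k → ℝ := fun l =>
        countExpect n k δ a' (fun x => f ((d + 1) • basisVec k i + (basisVec k l + x)))
      set Q : Fin k → ℝ := fun l =>
        countExpect n k δ a' (fun x => f ((d + 1) • basisVec k j + (basisVec k l + x)))
      set W := walkWindow (2 * δ / k) n
      have hPQ : ∀ l, P l - Q l ≤ W (d + 1) := by
        intro l
        have h := ih a' (d + 1) (fun x => f (basisVec k l + x)) (fun x => hf _)
        simp only [add_left_comm (basisVec k l)] at h
        exact h
      have hi : P i - Q j ≤ W (d + 2) := by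
        have h := ih a' (d + 2) f hf
        simp only [succ_nsmul _ (d + 1), add_assoc] at h
        simp only [P, Q]
        exact h
      have hj : P j - Q i ≤ W d := by
        have h := ih a' d (fun x => f (basisVec k i + basisVec k j + x)) (fun x => hf _)
        have e₁ : ∀ x, basisVec k i + basisVec k j + (d • basisVec k i + x)
            = (d + 1) • basisVec k i + (basisVec k j + x) := fun x => by
          rw [succ_nsmul]; abel
        have e₂ : ∀ x, basisVec k i + basisVec k j + (d • basisVec k j + x)
            = (d + 1) • basisVec k j + (basisVec k i + x) := fun x => by
          rw [succ_nsmul]; abel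
        simp only [e₁, e₂] at h
        exact h
      have hsplit : ∑ l, (P l - Q l) ≤ W (d + 2) + W d + (k - 2) * W (d + 1) := by
        rw [← Finset.sum_add_sum_compl {i, j}, Finset.sum_pair hij]
        have h := Finset.sum_le_card_nsmul ({i, j} : Finset (Fin k))ᶜ (fun l => P l - Q l)
          (W (d + 1)) (fun l _ => hPQ l)
        rw [Finset.card_compl, Finset.card_pair hij, Fintype.card_fin, nsmul_eq_mul,
          Nat.cast_sub hk] at h
        push_cast at h
        linarith
      rw [Finset.sum_sub_distrib] at hsplit
      have hk0 : (k : ℝ) ≠ 0 := by positivity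
      have h₁ := mul_le_mul_of_nonneg_left (hPQ (a 0)) (sub_nonneg.2 hδ1)
      have h₂ := mul_le_mul_of_nonneg_left hsplit (show 0 ≤ δ / (k : ℝ) by positivity)
      have hr : (1 - 2 * δ / k) * W (d + 1) + 2 * δ / k / 2 * (W (d + 2) + W d)
          = (1 - δ) * W (d + 1) + δ / k * (W (d + 2) + W d + (k - 2) * W (d + 1)) := by
        field_simp
        ring
      rw [hr]
      linarith

lemma tsum_shiftCountDist (n k : ℕ) (δ : ℝ) (a : Fin n → Fin k) (v : Fin k → ℤ)
    (A : Set (Fin k → ℤ)) :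
    ∑' x : A, shiftCountDist n k δ a v x
      = countExpect n k δ a (fun x => A.indicator 1 (v + x)) := by
  classical
  rw [_root_.tsum_subtype A (shiftCountDist n k δ a v),
    tsum_eq_sum (s := Finset.univ.image fun b => v + countVec n k b)]
  · simp only [Set.indicator_apply, shiftCountDist, countExpect, Pi.one_apply]
    simp only [← Finset.sum_filter]
    rw [Finset.sum_comm]
    refine Finset.sum_congr rfl fun b _ => ?_
    rw [← Finset.mul_sum, Finset.sum_ite_eq]
    simp
  · intro x hx
    refine Set.indicator_apply_eq_zero.2 fun _ => Finset.sum_eq_zero fun b _ => ?_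
    rw [if_neg, mul_zero]
    rintro rfl
    exact hx (Finset.mem_image_of_mem _ (Finset.mem_univ b))

/-- For every `k ≥ 2`, `n ≥ 1`, `0 < δ < 1`, and every pure profile `a ∈ [k]^n`,
`d_TV(e_1 + N(a^δ), e_2 + N(a^δ)) ≤ P(S_n^{2δ/k} ∈ {0,1})`. -/
theorem tv_shiftCount_le_walk (n k : ℕ) (hn : 1 ≤ n) (hk : 2 ≤ k)
    (δ : ℝ) (hδ0 : 0 < δ) (hδ1 : δ < 1) (a : Fin n → Fin k) :
    dTV (shiftCountDist n k δ a (basisVec k ⟨0, by omega⟩))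
        (shiftCountDist n k δ a (basisVec k ⟨1, by omega⟩))
      ≤ walk (2 * δ / k) n 0 + walk (2 * δ / k) n 1 := by
  refine csSup_le ⟨_, ∅, rfl⟩ ?_
  rintro _ ⟨A, rfl⟩
  have hA : ∀ x, A.indicator (1 : (Fin k → ℤ) → ℝ) x ∈ Set.Icc (0 : ℝ) 1 := fun x => by
    by_cases hx : x ∈ A <;> simp [hx]
  have key := fun (i j : Fin k) (hij : i ≠ j) =>
    countExpect_sub_le_walkWindow k hk δ hδ0.le hδ1.le i j hij n a 1 _ hA
  simp only [walkWindow, one_smul, Finset.sum_range_one, Nat.cast_zero, zero_add,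
    neg_zero] at key
  rw [tsum_shiftCountDist, tsum_shiftCountDist, add_comm (walk _ _ _)]
  refine abs_sub_le_iff.2 ⟨key _ _ ?_, key _ _ ?_⟩ <;> simp
end

section
/- For every n ≥ 2 and δ ∈ (0,1), the worst-case Lipschitz constant of δ-perturbed n-player 2-action anonymous games satisfies λ(n,2,δ) = (1-δ)·M(n-2,δ), where M(m,δ) = max_{l,s ∈ {0,…,m}} P(Σ_{i=1}^{l} X_i + Σ_{j=l+1}^{m} (1-X_j) = s) with X_1, X_2, … i.i.d. Bernoulli(δ/2) random variables, and M(0,δ) = 1 by convention. -/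
open Finset

/-- The probability of the event `E` when `ω : Fin n → Bool` is a vector of `n`
i.i.d. Bernoulli(`p`) random variables (`true` has probability `p`). -/
noncomputable def bernProb (n : ℕ) (p : ℝ) (E : (Fin n → Bool) → Prop)
    [DecidablePred E] : ℝ :=
  ∑ ω : Fin n → Bool, (∏ i, if ω i then p else 1 - p) * (if E ω then 1 else 0)

/-- `{0,1}`-valued indicator of a Boolean. -/
def bInd (b : Bool) : ℕ := if b then 1 else 0

/-- The statistic `Σ_{i=1}^{l} X_i + Σ_{j=l+1}^{n} (1 - X_j)` for the outcome `ω`. -/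
def bStat (n l : ℕ) (ω : Fin n → Bool) : ℕ :=
  ∑ i : Fin n, if (i : ℕ) < l then bInd (ω i) else 1 - bInd (ω i)

/-- `M(n,δ) = max_{l,s ∈ {0,…,n}} P(Σ_{i=1}^{l} X_i + Σ_{j=l+1}^{n} (1-X_j) = s)`,
where `X_1, X_2, …` are i.i.d. Bernoulli(`δ/2`); `M(0,δ) = 1`. -/
noncomputable def Mmax (n : ℕ) (δ : ℝ) : ℝ :=
  sSup {x | ∃ l s : ℕ, l ≤ n ∧ s ≤ n ∧ x = bernProb n (δ / 2) (fun ω => bStat n l ω = s)}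

/-- `P_m = P(Σ_{i=1}^{m} X_i + Σ_{j=m+1}^{2m} (1-X_j) = m)`, where `X_1, X_2, …`
are i.i.d. Bernoulli(`δ/2`). -/
noncomputable def Pdiag (m : ℕ) (δ : ℝ) : ℝ :=
  bernProb (2 * m) (δ / 2) (fun ω => bStat (2 * m) m ω = m)

section

open Polynomial

/-- The linear functional `∑ s, q_s X^s ↦ ∑ s, q_s H(s)`. -/
noncomputable def weightedSum (H : ℕ → ℝ) : ℝ[X] →ₗ[ℝ] ℝ :=
  Polynomial.lsum fun s => H s • LinearMap.id

lemma weightedSum_monomial (H : ℕ → ℝ) (s : ℕ) (c : ℝ) :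
    weightedSum H (monomial s c) = H s * c := by
  rw [weightedSum, Polynomial.lsum_apply, Polynomial.sum_monomial_index]
  · simp
  · simp

lemma weightedSum_X_pow_mul (H : ℕ → ℝ) (c : ℕ) (p : ℝ[X]) :
    weightedSum H (X ^ c * p) = weightedSum (fun t => H (t + c)) p := by
  induction p using Polynomial.induction_on' with
  | add p q hp hq => rw [mul_add, map_add, map_add, hp, hq]
  | monomial s a =>
    rw [X_pow_eq_monomial, monomial_mul_monomial, weightedSum_monomial, weightedSum_monomial,
      one_mul, add_comm]

lemma weightedSum_eq_sum_range (H : ℕ → ℝ) (p : ℝ[X]) :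
    weightedSum H p = ∑ s ∈ Finset.range (p.natDegree + 1), H s * p.coeff s := by
  rw [weightedSum, Polynomial.lsum_apply, Polynomial.sum_over_range]
  · simp
  · simp

lemma weightedSum_X_sub_one_mul (H : ℕ → ℝ) (p : ℝ[X]) :
    weightedSum H ((X - 1) * p) =
      ∑ s ∈ Finset.range (p.natDegree + 1), p.coeff s * (H (s + 1) - H s) := by
  have h := weightedSum_X_pow_mul H 1 p
  rw [pow_one] at h
  rw [sub_mul, one_mul, map_sub, h, weightedSum_eq_sum_range, weightedSum_eq_sum_range,
    ← Finset.sum_sub_distrib]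
  exact Finset.sum_congr rfl fun s _ => by ring

lemma weightedSum_indicator (s : ℕ) (p : ℝ[X]) :
    weightedSum (fun t => if t = s then 1 else 0) p = p.coeff s := by
  rw [weightedSum_eq_sum_range]
  simp only [ite_mul, one_mul, zero_mul, Finset.sum_ite_eq', Finset.mem_range]
  split_ifs with h
  · rfl
  · exact (coeff_eq_zero_of_natDegree_lt (by omega)).symm

lemma weightedSum_indicator_gt (s : ℕ) (p : ℝ[X]) :
    weightedSum (fun t => if s < t then 1 else 0) ((X - 1) * p) = p.coeff s := by
  rw [← weightedSum_indicator, weightedSum_X_sub_one_mul, weightedSum_eq_sum_range]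
  refine Finset.sum_congr rfl fun t _ => ?_
  rcases lt_trichotomy t s with h | rfl | h
  · simp [show ¬ s < t + 1 by omega, show ¬ s < t by omega, h.ne]
  · simp
  · simp [show s < t + 1 by omega, h, h.ne']

/-- The law of a sum of independent variables, read off the product of generating functions. -/
lemma sum_prod_mul_eq_weightedSum {ι α : Type*} [Fintype ι] [DecidableEq ι] [Fintype α]
    (w : ι → α → ℝ) (v : ι → α → ℕ) (H : ℕ → ℝ) :
    ∑ ω : ι → α, (∏ i, w i (ω i)) * H (∑ i, v i (ω i)) =
      weightedSum H (∏ i, ∑ c, monomial (v i c) (w i c)) := by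
  have hprod : ∀ (ω : ι → α) (S : Finset ι),
      ∏ i ∈ S, monomial (v i (ω i)) (w i (ω i)) =
        monomial (∑ i ∈ S, v i (ω i)) (∏ i ∈ S, w i (ω i)) := by
    intro ω S
    induction S using Finset.induction_on with
    | empty => simp
    | insert i S hi ih =>
      rw [Finset.prod_insert hi, Finset.prod_insert hi, Finset.sum_insert hi, ih,
        monomial_mul_monomial]
  rw [Finset.prod_univ_sum, Fintype.piFinset_univ, map_sum]
  refine Finset.sum_congr rfl fun ω _ => ?_
  rw [hprod, weightedSum_monomial, mul_comm]

/-- A nonnegative sequence is log-concave, in the form that also excludes internal zeros. -/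
def IsLogConcaveSeq (f : ℕ → ℝ) : Prop :=
  (∀ s, 0 ≤ f s) ∧ ∀ a b, a ≤ b → f a * f (b + 2) ≤ f (a + 1) * f (b + 1)

lemma IsLogConcaveSeq.linear_mul {p : ℝ[X]} (hp : IsLogConcaveSeq p.coeff) {u v : ℝ}
    (hu : 0 ≤ u) (hv : 0 ≤ v) : IsLogConcaveSeq ((C u + C v * X) * p).coeff := by
  obtain ⟨h0, hlc⟩ := hp
  have hz : ((C u + C v * X) * p).coeff 0 = u * p.coeff 0 := by simp [add_mul, mul_assoc]
  have hs : ∀ s, ((C u + C v * X) * p).coeff (s + 1) = u * p.coeff (s + 1) + v * p.coeff s := by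
    intro s
    simp [add_mul, mul_assoc]
  generalize p.coeff = f at *
  refine ⟨fun s => ?_, fun a b hab => ?_⟩
  · cases s with
    | zero => rw [hz]; exact mul_nonneg hu (h0 _)
    | succ s => rw [hs]; exact add_nonneg (mul_nonneg hu (h0 _)) (mul_nonneg hv (h0 _))
  · cases a with
    | zero =>
      rw [hz, hs, hs, hs]
      have h1 := mul_le_mul_of_nonneg_left (hlc 0 b hab) (mul_nonneg hu hu)
      have h2 := mul_nonneg (mul_nonneg hv hv) (mul_nonneg (h0 0) (h0 b))
      have h3 := mul_nonneg (mul_nonneg hu hv) (mul_nonneg (h0 1) (h0 b))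
      simp only [zero_add] at *
      linarith
    | succ a =>
      obtain ⟨b, rfl⟩ : ∃ b', b = b' + 1 := ⟨b - 1, by omega⟩
      have hab' : a ≤ b := by omega
      rw [hs, hs, hs, hs]
      have h1 := mul_le_mul_of_nonneg_left (hlc (a + 1) (b + 1) hab) (mul_nonneg hu hu)
      have h2 := mul_le_mul_of_nonneg_left (hlc a b hab') (mul_nonneg hv hv)
      have h3 : f a * f (b + 3) ≤ f (a + 2) * f (b + 1) := by
        refine (hlc a (b + 1) (by omega)).trans ?_
        rcases hab'.eq_or_lt with rfl | h
        · exact (mul_comm _ _).le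
        · exact hlc (a + 1) b h
      have h4 := mul_le_mul_of_nonneg_left h3 (mul_nonneg hu hv)
      simp only [add_assoc, Nat.reduceAdd] at *
      linarith

lemma IsLogConcaveSeq.linear_pow_mul {p : ℝ[X]} (hp : IsLogConcaveSeq p.coeff) {u v : ℝ}
    (hu : 0 ≤ u) (hv : 0 ≤ v) (l : ℕ) : IsLogConcaveSeq ((C u + C v * X) ^ l * p).coeff := by
  induction l with
  | zero => simpa using hp
  | succ l ih =>
    rw [pow_succ', mul_assoc]
    exact ih.linear_mul hu hv

lemma IsLogConcaveSeq.le_succ_of_lt {f : ℕ → ℝ} (hf : IsLogConcaveSeq f) {M : ℕ}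
    (hM : ∀ s, f s ≤ f M) {s : ℕ} (hs : s < M) : f s ≤ f (s + 1) := by
  rcases (hf.1 M).eq_or_lt with h | h
  · exact (hM s).trans (h ▸ hf.1 _)
  rcases Nat.lt_or_ge (s + 1) M with h1 | h1
  · obtain ⟨b, rfl⟩ : ∃ b, M = b + 2 := ⟨M - 2, by omega⟩
    exact le_of_mul_le_mul_right ((hf.2 s b (by omega)).trans
      (mul_le_mul_of_nonneg_left (hM _) (hf.1 _))) h
  · rw [show s + 1 = M by omega]
    exact hM s

lemma IsLogConcaveSeq.succ_le_of_le {f : ℕ → ℝ} (hf : IsLogConcaveSeq f) {M : ℕ}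
    (hM : ∀ s, f s ≤ f M) {s : ℕ} (hs : M ≤ s) : f (s + 1) ≤ f s := by
  rcases (hf.1 M).eq_or_lt with h | h
  · exact (hM _).trans (h ▸ hf.1 _)
  rcases hs.eq_or_lt with rfl | h1
  · exact hM _
  · obtain ⟨b, rfl⟩ : ∃ b, s = b + 1 := ⟨s - 1, by omega⟩
    exact le_of_mul_le_mul_left ((hf.2 M b (by omega)).trans
      (mul_le_mul_of_nonneg_right (hM _) (hf.1 _))) h

/-- Summation by parts against a unimodal sequence is bounded by the mode. -/
lemma IsLogConcaveSeq.sum_mul_sub_le {f : ℕ → ℝ} (hf : IsLogConcaveSeq f) {M : ℕ}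
    (hM : ∀ s, f s ≤ f M) {H : ℕ → ℝ} (hH : ∀ s, H s ∈ Set.Icc (0 : ℝ) 1) {N : ℕ}
    (hN : M ≤ N) : ∑ s ∈ Finset.range N, f s * (H (s + 1) - H s) ≤ f M := by
  have hup : ∀ k ≤ M, ∑ s ∈ Finset.range k, f s * (H (s + 1) - H s) ≤ f k * H k := by
    intro k
    induction k with
    | zero => intro _; simpa using mul_nonneg (hf.1 0) (hH 0).1
    | succ k ih =>
      intro hk
      rw [Finset.sum_range_succ]
      have := mul_le_mul_of_nonneg_right (hf.le_succ_of_lt hM hk) (hH (k + 1)).1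
      linarith [ih (by omega)]
  have hdown : ∑ s ∈ Finset.range N, f s * (H (s + 1) - H s) ≤ f M - f N * (1 - H N) := by
    induction N, hN using Nat.le_induction with
    | base => linarith [hup M le_rfl]
    | succ k hk ih =>
      rw [Finset.sum_range_succ]
      have := mul_le_mul_of_nonneg_right (hf.succ_le_of_le hM hk)
        (sub_nonneg.2 (hH (k + 1)).2)
      linarith
  linarith [mul_nonneg (hf.1 N) (sub_nonneg.2 (hH N).2)]

lemma abs_weightedSum_X_sub_one_mul_le {p : ℝ[X]} (hp : IsLogConcaveSeq p.coeff) {K : ℝ}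
    (hK : ∀ s, p.coeff s ≤ K) {H : ℕ → ℝ} (hH : ∀ s, H s ∈ Set.Icc (0 : ℝ) 1) :
    |weightedSum H ((X - 1) * p)| ≤ K := by
  obtain ⟨M, hMmem, hMmax⟩ :=
    Finset.exists_max_image (Finset.range (p.natDegree + 1)) p.coeff ⟨0, Finset.mem_range.2 (Nat.succ_pos _)⟩
  have hM : ∀ s, p.coeff s ≤ p.coeff M := by
    intro s
    by_cases hs : s ∈ Finset.range (p.natDegree + 1)
    · exact hMmax s hs
    · rw [coeff_eq_zero_of_natDegree_lt (by rw [Finset.mem_range] at hs; omega)]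
      exact hp.1 M
  have hMN : M ≤ p.natDegree + 1 := (Finset.mem_range.1 hMmem).le
  have hH' : ∀ s, 1 - H s ∈ Set.Icc (0 : ℝ) 1 := fun s =>
    ⟨sub_nonneg.2 (hH s).2, sub_le_self _ (hH s).1⟩
  have h1 := hp.sum_mul_sub_le hM hH hMN
  have h2 := hp.sum_mul_sub_le hM hH' hMN
  have h3 : ∑ s ∈ Finset.range (p.natDegree + 1), p.coeff s * (1 - H (s + 1) - (1 - H s)) =
      -∑ s ∈ Finset.range (p.natDegree + 1), p.coeff s * (H (s + 1) - H s) := by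
    rw [← Finset.sum_neg_distrib]
    exact Finset.sum_congr rfl fun s _ => by ring
  rw [weightedSum_X_sub_one_mul, abs_le]
  constructor <;> linarith [hK M]

/-- The generating function of the `δ`-perturbation of a pure action. -/
noncomputable def actionGF (δ : ℝ) (c : Fin 2) : ℝ[X] :=
  ∑ x : Fin 2, monomial (x : ℕ) (perturbW 2 δ c x)

lemma actionGF_zero (δ : ℝ) : actionGF δ 0 = C (1 - δ / 2) + C (δ / 2) * X := by
  have h0 : perturbW 2 δ 0 0 = 1 - δ / 2 := by
    norm_num [perturbW]
    ring
  have h1 : perturbW 2 δ 0 1 = δ / 2 := by norm_num [perturbW]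
  rw [actionGF, Fin.sum_univ_two, h0, h1, C_mul_X_eq_monomial]
  rfl

lemma actionGF_one (δ : ℝ) : actionGF δ 1 = C (δ / 2) + C (1 - δ / 2) * X := by
  have h0 : perturbW 2 δ 1 0 = δ / 2 := by norm_num [perturbW]
  have h1 : perturbW 2 δ 1 1 = 1 - δ / 2 := by
    norm_num [perturbW]
    ring
  rw [actionGF, Fin.sum_univ_two, h0, h1, C_mul_X_eq_monomial]
  rfl

lemma actionGF_one_sub_zero (δ : ℝ) :
    actionGF δ 1 - actionGF δ 0 = C (1 - δ) * (X - 1) := by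
  rw [actionGF_zero, actionGF_one]
  have h : (C (1 - δ) : ℝ[X]) = C (1 - δ / 2) - C (δ / 2) := by
    rw [← C_sub]
    congr 1
    ring
  rw [h]
  ring

/-- The generating function of a crowd of `l` players taking action `0` and `r` players taking
action `1`. -/
noncomputable def crowdGF (δ : ℝ) (l r : ℕ) : ℝ[X] :=
  actionGF δ 0 ^ l * actionGF δ 1 ^ r

lemma isLogConcaveSeq_crowdGF {δ : ℝ} (h0 : 0 ≤ δ) (h1 : δ ≤ 1) (l r : ℕ) :
    IsLogConcaveSeq (crowdGF δ l r).coeff := by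
  have hu : 0 ≤ δ / 2 := by linarith
  have hv : 0 ≤ 1 - δ / 2 := by linarith
  have hone : IsLogConcaveSeq (1 : ℝ[X]).coeff := by
    refine ⟨fun s => ?_, fun a b _ => ?_⟩
    · rw [coeff_one]
      split_ifs <;> norm_num
    · simp [coeff_one]
  rw [crowdGF, actionGF_zero, actionGF_one, ← mul_one (_ ^ r)]
  exact (hone.linear_pow_mul hu hv r).linear_pow_mul hv hu l

lemma natDegree_crowdGF_le (δ : ℝ) (l r : ℕ) : (crowdGF δ l r).natDegree ≤ l + r := by
  have h : ∀ u v : ℝ, (C u + C v * X : ℝ[X]).natDegree ≤ 1 := fun u v => by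
    rw [add_comm]
    exact natDegree_linear_le
  rw [crowdGF, actionGF_zero, actionGF_one]
  refine natDegree_mul_le.trans (add_le_add ?_ ?_)
  · exact (natDegree_pow_le_of_le l (h _ _)).trans (by simp)
  · exact (natDegree_pow_le_of_le r (h _ _)).trans (by simp)

lemma prod_actionGF {ι : Type*} (δ : ℝ) (S : Finset ι) (a : ι → Fin 2) :
    ∏ k ∈ S, actionGF δ (a k) =
      crowdGF δ (S.filter fun k => a k = 0).card
        (S.card - (S.filter fun k => a k = 0).card) := by
  have h : ∀ k, actionGF δ (a k) = if a k = 0 then actionGF δ 0 else actionGF δ 1 := fun k => by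
    split_ifs with hk
    · rw [hk]
    · rw [Fin.eq_one_of_ne_zero _ hk]
  rw [Finset.prod_congr rfl fun k _ => h k, Finset.prod_ite, Finset.prod_const,
    Finset.prod_const, crowdGF, ← Finset.card_filter_add_card_filter_not (s := S) (fun k => a k = 0),
    Nat.add_sub_cancel_left]

/-- The payoffs of the perturbed game, for a payoff depending only on the own action and on the
number of players taking action `1`. -/
lemma perturbGame_two_eq {n : ℕ} {δ : ℝ} {g : (Fin n → Fin 2) → Fin n → ℝ} {i : Fin n}
    {G : Fin 2 → ℕ → ℝ} (hG : ∀ b, g b i = G (b i) (∑ k, (b k : ℕ))) (a : Fin n → Fin 2) :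
    perturbGame n 2 δ g a i = ∑ c : Fin 2, perturbW 2 δ (a i) c *
      weightedSum (fun t => G c (t + c)) (∏ k ∈ Finset.univ.erase i, actionGF δ (a k)) := by
  have hc : ∀ c : Fin 2, perturbW 2 δ (a i) c *
      weightedSum (fun t => G c (t + c)) (∏ k ∈ Finset.univ.erase i, actionGF δ (a k)) =
      ∑ b : Fin n → Fin 2, if b i = c then profW n 2 δ a b * G c (∑ k, (b k : ℕ)) else 0 := by
    intro c
    have h := sum_prod_mul_eq_weightedSum
      (fun k x => if k = i then (if x = c then perturbW 2 δ (a i) c else 0)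
        else perturbW 2 δ (a k) x) (fun _ (x : Fin 2) => (x : ℕ)) (G c)
    rw [← Finset.mul_prod_erase _ _ (Finset.mem_univ i)] at h
    have h1 : ∏ k ∈ Finset.univ.erase i, ∑ x : Fin 2, monomial (x : ℕ)
        (if k = i then (if x = c then perturbW 2 δ (a i) c else 0) else perturbW 2 δ (a k) x) =
        ∏ k ∈ Finset.univ.erase i, actionGF δ (a k) :=
      Finset.prod_congr rfl fun k hk => by simp [actionGF, Finset.ne_of_mem_erase hk]
    have h2 : ∑ x : Fin 2, monomial (x : ℕ) (if i = i then
        (if x = c then perturbW 2 δ (a i) c else 0) else perturbW 2 δ (a i) x) =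
        perturbW 2 δ (a i) c • (X : ℝ[X]) ^ (c : ℕ) := by
      rw [Finset.sum_eq_single c]
      · simp [X_pow_eq_monomial, smul_monomial]
      · intro x _ hx
        simp [hx]
      · simp
    rw [h1, h2, smul_mul_assoc, map_smul, weightedSum_X_pow_mul, smul_eq_mul] at h
    rw [← h]
    refine Finset.sum_congr rfl fun b _ => ?_
    rw [← Finset.mul_prod_erase _ _ (Finset.mem_univ i), if_pos rfl, profW,
      ← Finset.mul_prod_erase _ _ (Finset.mem_univ i)]
    have h3 : ∏ k ∈ Finset.univ.erase i, (if k = i then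
        (if b k = c then perturbW 2 δ (a i) c else 0) else perturbW 2 δ (a k) (b k)) =
        ∏ k ∈ Finset.univ.erase i, perturbW 2 δ (a k) (b k) :=
      Finset.prod_congr rfl fun k hk => by simp [Finset.ne_of_mem_erase hk]
    rw [h3]
    split_ifs with hb
    · rw [hb]
    · ring
  rw [Finset.sum_congr rfl fun c _ => hc c, Finset.sum_comm, perturbGame]
  refine Finset.sum_congr rfl fun b _ => ?_
  rw [Finset.sum_ite_eq, if_pos (Finset.mem_univ _), hG]

/-- The effect on player `i`'s perturbed payoff of player `j` moving from action `0` to `1`. -/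
lemma perturbGame_two_sub {n : ℕ} {δ : ℝ} {g : (Fin n → Fin 2) → Fin n → ℝ} {i j : Fin n}
    {G : Fin 2 → ℕ → ℝ} (hG : ∀ b, g b i = G (b i) (∑ k, (b k : ℕ))) (hij : j ≠ i)
    {a b : Fin n → Fin 2} (ha : a j = 0) (hb : b j = 1) (hab : ∀ k, k ≠ j → a k = b k) :
    perturbGame n 2 δ g b i - perturbGame n 2 δ g a i =
      (1 - δ) * ∑ c : Fin 2, perturbW 2 δ (a i) c * weightedSum (fun t => G c (t + c))
        ((X - 1) * ∏ k ∈ (Finset.univ.erase i).erase j, actionGF δ (a k)) := by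
  have hj : j ∈ (Finset.univ : Finset (Fin n)).erase i :=
    Finset.mem_erase.2 ⟨hij, Finset.mem_univ j⟩
  have hR : ∏ k ∈ (Finset.univ.erase i).erase j, actionGF δ (b k) =
      ∏ k ∈ (Finset.univ.erase i).erase j, actionGF δ (a k) :=
    Finset.prod_congr rfl fun k hk => by rw [hab k (Finset.ne_of_mem_erase hk)]
  rw [perturbGame_two_eq hG, perturbGame_two_eq hG, ← hab i hij.symm, ← Finset.sum_sub_distrib,
    Finset.mul_sum]
  refine Finset.sum_congr rfl fun c _ => ?_
  rw [← Finset.mul_prod_erase _ _ hj, ← Finset.mul_prod_erase _ _ hj, hR, ha, hb, ← mul_sub,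
    ← map_sub, ← sub_mul, actionGF_one_sub_zero, mul_assoc, ← smul_eq_C_mul, map_smul,
    smul_eq_mul, mul_left_comm]

lemma perturbW_two_nonneg {δ : ℝ} (h0 : 0 ≤ δ) (h1 : δ ≤ 1) (c x : Fin 2) :
    0 ≤ perturbW 2 δ c x := by
  have : 0 ≤ 1 - δ := by linarith
  rw [perturbW]
  split_ifs <;> positivity

lemma sum_perturbW_two (δ : ℝ) (c : Fin 2) : ∑ x, perturbW 2 δ c x = 1 := by
  simp only [perturbW, Finset.sum_add_distrib, ← Finset.mul_sum]
  simp
  ring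

lemma bernProb_bStat_eq_coeff {m l : ℕ} (hl : l ≤ m) (δ : ℝ) (s : ℕ) :
    bernProb m (δ / 2) (fun ω => bStat m l ω = s) = (crowdGF δ l (m - l)).coeff s := by
  have h := sum_prod_mul_eq_weightedSum
    (fun (_ : Fin m) (x : Bool) => if x then δ / 2 else 1 - δ / 2)
    (fun k x => if (k : ℕ) < l then bInd x else 1 - bInd x) (fun t => if t = s then 1 else 0)
  have hfac : ∀ k : Fin m, ∑ x : Bool, monomial (if (k : ℕ) < l then bInd x else 1 - bInd x)
      (if x then δ / 2 else 1 - δ / 2) =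
      if (k : ℕ) < l then actionGF δ 0 else actionGF δ 1 := by
    intro k
    rw [actionGF_zero, actionGF_one]
    split_ifs <;> simp [bInd, C_mul_X_eq_monomial, add_comm, -map_sub]
  have hcard : (Finset.univ.filter fun k : Fin m => (k : ℕ) < l).card = l := by
    rw [Fin.card_filter_val_lt, min_eq_right hl]
  have hcard' : (Finset.univ.filter fun k : Fin m => ¬ (k : ℕ) < l).card = m - l := by
    have := Finset.card_filter_add_card_filter_not (s := (Finset.univ : Finset (Fin m)))
      (fun k : Fin m => (k : ℕ) < l)
    rw [hcard, Finset.card_univ, Fintype.card_fin] at this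
    omega
  rw [Finset.prod_congr rfl fun k _ => hfac k, Finset.prod_ite, Finset.prod_const,
    Finset.prod_const, hcard, hcard', weightedSum_indicator] at h
  exact h

lemma finite_setOf_bernProb (m : ℕ) (δ : ℝ) :
    {x | ∃ l s : ℕ, l ≤ m ∧ s ≤ m ∧
      x = bernProb m (δ / 2) (fun ω => bStat m l ω = s)}.Finite := by
  refine (((Set.finite_Iic m).prod (Set.finite_Iic m)).image fun q : ℕ × ℕ =>
    bernProb m (δ / 2) (fun ω => bStat m q.1 ω = q.2)).subset ?_
  rintro x ⟨l, s, hl, hs, rfl⟩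
  exact ⟨(l, s), ⟨hl, hs⟩, rfl⟩

lemma exists_Mmax_eq_coeff (m : ℕ) (δ : ℝ) :
    ∃ l ≤ m, ∃ s, Mmax m δ = (crowdGF δ l (m - l)).coeff s := by
  have hne : {x | ∃ l s : ℕ, l ≤ m ∧ s ≤ m ∧
      x = bernProb m (δ / 2) (fun ω => bStat m l ω = s)}.Nonempty :=
    ⟨_, 0, 0, Nat.zero_le m, Nat.zero_le m, rfl⟩
  obtain ⟨l, s, hl, -, h⟩ := hne.csSup_mem (finite_setOf_bernProb m δ)
  exact ⟨l, hl, s, h.trans (bernProb_bStat_eq_coeff hl δ s)⟩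

lemma coeff_le_Mmax {δ : ℝ} (h0 : 0 ≤ δ) (h1 : δ ≤ 1) {m l : ℕ} (hl : l ≤ m) (s : ℕ) :
    (crowdGF δ l (m - l)).coeff s ≤ Mmax m δ := by
  by_cases hs : s ≤ m
  · rw [← bernProb_bStat_eq_coeff hl]
    exact le_csSup (finite_setOf_bernProb m δ).bddAbove ⟨l, s, hl, hs, rfl⟩
  · have hdeg := natDegree_crowdGF_le δ l (m - l)
    rw [coeff_eq_zero_of_natDegree_lt (by omega)]
    obtain ⟨l', -, s', h⟩ := exists_Mmax_eq_coeff m δ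
    exact h ▸ (isLogConcaveSeq_crowdGF h0 h1 _ _).1 s'

lemma actCount_two_one {n : ℕ} (b : Fin n → Fin 2) :
    actCount n 2 b 1 = ∑ k, (b k : ℕ) := by
  rw [actCount, Finset.card_filter]
  refine Finset.sum_congr rfl fun k _ => ?_
  generalize b k = c
  fin_cases c <;> rfl

lemma actCount_two_zero {n : ℕ} (b : Fin n → Fin 2) :
    actCount n 2 b 0 = n - ∑ k, (b k : ℕ) := by
  have h := Finset.card_filter_add_card_filter_not (s := (Finset.univ : Finset (Fin n)))
    (fun k => b k = 0)
  have h1 : (Finset.univ.filter fun k => ¬ b k = 0) = Finset.univ.filter fun k => b k = 1 :=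
    Finset.filter_congr fun k _ => by lia
  rw [h1, Finset.card_univ, Fintype.card_fin] at h
  rw [← actCount_two_one, actCount, actCount]
  omega

lemma exists_payoff_of_isAnonymous {n : ℕ} {g : (Fin n → Fin 2) → Fin n → ℝ}
    (hg : IsGame n 2 g) (ha : IsAnonymous n 2 g) (i : Fin n) :
    ∃ G : Fin 2 → ℕ → ℝ, (∀ c t, G c t ∈ Set.Icc (0 : ℝ) 1) ∧
      ∀ b, g b i = G (b i) (∑ k, (b k : ℕ)) := by
  classical
  refine ⟨fun c t => if h : ∃ b : Fin n → Fin 2, b i = c ∧ ∑ k, (b k : ℕ) = t then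
    g h.choose i else 0, fun c t => ?_, fun b => ?_⟩
  · dsimp only
    split_ifs with h
    · exact hg _ _
    · simp
  · have h : ∃ b' : Fin n → Fin 2, b' i = b i ∧ ∑ k, (b' k : ℕ) = ∑ k, (b k : ℕ) :=
      ⟨b, rfl, rfl⟩
    dsimp only
    rw [dif_pos h]
    refine ha _ _ _ h.choose_spec.1.symm fun j => ?_
    fin_cases j
    · change actCount n 2 _ 0 = actCount n 2 _ 0
      rw [actCount_two_zero, actCount_two_zero, h.choose_spec.2]
    · change actCount n 2 _ 1 = actCount n 2 _ 1
      rw [actCount_two_one, actCount_two_one, h.choose_spec.2]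

lemma card_erase_erase {n : ℕ} {i j : Fin n} (hij : j ≠ i) :
    ((Finset.univ.erase i).erase j).card = n - 2 := by
  rw [Finset.card_erase_of_mem (Finset.mem_erase.2 ⟨hij, Finset.mem_univ j⟩),
    Finset.card_erase_of_mem (Finset.mem_univ i), Finset.card_univ, Fintype.card_fin]
  omega

lemma abs_perturbGame_two_sub_le {n : ℕ} {δ : ℝ} (h0 : 0 ≤ δ) (h1 : δ ≤ 1)
    {g : (Fin n → Fin 2) → Fin n → ℝ} (hg : IsGame n 2 g) (ha : IsAnonymous n 2 g)
    {i j : Fin n} (hij : j ≠ i) {a b : Fin n → Fin 2} (haj : a j = 0) (hbj : b j = 1)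
    (hab : ∀ k, k ≠ j → a k = b k) :
    |perturbGame n 2 δ g b i - perturbGame n 2 δ g a i| ≤ (1 - δ) * Mmax (n - 2) δ := by
  obtain ⟨G, hG01, hG⟩ := exists_payoff_of_isAnonymous hg ha i
  have h1δ : 0 ≤ 1 - δ := by linarith
  rw [perturbGame_two_sub hG hij haj hbj hab, abs_mul, abs_of_nonneg h1δ]
  refine mul_le_mul_of_nonneg_left ?_ h1δ
  rw [prod_actionGF, card_erase_erase hij]
  have hl := (Finset.card_filter_le ((Finset.univ.erase i).erase j) fun k => a k = 0).trans_eq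
    (card_erase_erase hij)
  calc |∑ c : Fin 2, perturbW 2 δ (a i) c * _|
      ≤ ∑ c : Fin 2, perturbW 2 δ (a i) c * Mmax (n - 2) δ := by
        refine (Finset.abs_sum_le_sum_abs _ _).trans (Finset.sum_le_sum fun c _ => ?_)
        rw [abs_mul, abs_of_nonneg (perturbW_two_nonneg h0 h1 _ _)]
        exact mul_le_mul_of_nonneg_left
          (abs_weightedSum_X_sub_one_mul_le (isLogConcaveSeq_crowdGF h0 h1 _ _)
            (coeff_le_Mmax h0 h1 hl) fun t => hG01 _ _) (perturbW_two_nonneg h0 h1 _ _)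
    _ = Mmax (n - 2) δ := by rw [← Finset.sum_mul, sum_perturbW_two, one_mul]

lemma abs_perturbGame_two_sub_le_of_card_eq_one {n : ℕ} {δ : ℝ} (h0 : 0 ≤ δ) (h1 : δ ≤ 1)
    {g : (Fin n → Fin 2) → Fin n → ℝ} (hg : IsGame n 2 g) (ha : IsAnonymous n 2 g)
    {i : Fin n} {a b : Fin n → Fin 2} (hi : a i = b i)
    (hab : (Finset.univ.filter fun j => a j ≠ b j).card = 1) :
    |perturbGame n 2 δ g a i - perturbGame n 2 δ g b i| ≤ (1 - δ) * Mmax (n - 2) δ := by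
  obtain ⟨j, hj⟩ := Finset.card_eq_one.1 hab
  have hmem : ∀ k, a k ≠ b k ↔ k = j := fun k => by
    rw [← Finset.mem_singleton, ← hj]
    simp
  have hij : j ≠ i := fun h => (hmem j).2 rfl (h ▸ hi)
  have hne := (hmem j).2 rfl
  have heq : ∀ k, k ≠ j → a k = b k := fun k hk => not_not.1 fun h => hk ((hmem k).1 h)
  by_cases haj : a j = 0
  · rw [abs_sub_comm]
    exact abs_perturbGame_two_sub_le h0 h1 hg ha hij haj
      (Fin.eq_one_of_ne_zero _ fun h => hne (haj.trans h.symm)) heq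
  · have haj' := Fin.eq_one_of_ne_zero _ haj
    have hbj : b j = 0 := by
      by_contra h
      exact hne (haj'.trans (Fin.eq_one_of_ne_zero _ h).symm)
    exact abs_perturbGame_two_sub_le h0 h1 hg ha hij hbj haj' fun k hk => (heq k hk).symm

lemma lipC_perturbGame_two_le {n : ℕ} (hn : 2 ≤ n) {δ : ℝ} (h0 : 0 ≤ δ) (h1 : δ ≤ 1)
    {g : (Fin n → Fin 2) → Fin n → ℝ} (hg : IsGame n 2 g) (ha : IsAnonymous n 2 g) :
    lipC n 2 (perturbGame n 2 δ g) ≤ (1 - δ) * Mmax (n - 2) δ := by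
  refine csSup_le ⟨_, ⟨0, by omega⟩, fun _ => 0,
    Function.update (fun _ => 0) ⟨1, by omega⟩ 1, ?_, ?_, rfl⟩ ?_
  · simp
  · rw [Finset.card_eq_one]
    refine ⟨⟨1, by omega⟩, ?_⟩
    ext k
    by_cases hk : k = ⟨1, by omega⟩ <;> simp [Function.update_apply, hk]
  · rintro x ⟨i, a, b, hi, hab, rfl⟩
    exact abs_perturbGame_two_sub_le_of_card_eq_one h0 h1 hg ha hi hab

/-- The game in which a player is paid iff more than `s` opponents take action `1`. -/
noncomputable def thresholdGame (n s : ℕ) (b : Fin n → Fin 2) (i : Fin n) : ℝ :=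
  if s + b i < ∑ k, (b k : ℕ) then 1 else 0

lemma isGame_thresholdGame (n s : ℕ) : IsGame n 2 (thresholdGame n s) := fun b i => by
  rw [thresholdGame]
  split_ifs <;> simp

lemma isAnonymous_thresholdGame (n s : ℕ) : IsAnonymous n 2 (thresholdGame n s) :=
  fun a b i hi hab => by
    rw [thresholdGame, thresholdGame, hi, ← actCount_two_one, ← actCount_two_one, hab]

lemma exists_perturbGame_thresholdGame_sub {n : ℕ} (hn : 2 ≤ n) (δ : ℝ) {l : ℕ}
    (hl : l ≤ n - 2) (s : ℕ) :
    ∃ (i : Fin n) (a b : Fin n → Fin 2), a i = b i ∧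
      (Finset.univ.filter fun j => a j ≠ b j).card = 1 ∧
      perturbGame n 2 δ (thresholdGame n s) a i - perturbGame n 2 δ (thresholdGame n s) b i =
        (1 - δ) * (crowdGF δ l (n - 2 - l)).coeff s := by
  set i : Fin n := ⟨0, by omega⟩ with hi
  set j : Fin n := ⟨1, by omega⟩ with hj
  have hij : j ≠ i := by simp [hi, hj]
  obtain ⟨S, hS, hScard⟩ := Finset.exists_subset_card_eq (hl.trans_eq (card_erase_erase hij).symm)
  set b : Fin n → Fin 2 := fun k => if k ∈ S then 0 else 1 with hb
  have hjS : j ∉ S := fun h => Finset.ne_of_mem_erase (hS h) rfl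
  have hbj : b j = 1 := if_neg hjS
  refine ⟨i, b, Function.update b j 0, ?_, ?_, ?_⟩
  · rw [Function.update_of_ne hij.symm]
  · rw [Finset.card_eq_one]
    refine ⟨j, ?_⟩
    ext k
    by_cases hk : k = j
    · simp [hk, hbj]
    · simp [hk]
  · rw [perturbGame_two_sub (G := fun c t => if s + c < t then 1 else 0) (fun _ => rfl) hij
      (Function.update_self j 0 b) hbj fun k hk => Function.update_of_ne hk 0 b]
    have hprod : ∏ k ∈ (Finset.univ.erase i).erase j, actionGF δ (Function.update b j 0 k) =
        crowdGF δ l (n - 2 - l) := by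
      have hfilter : ((Finset.univ.erase i).erase j).filter (fun k => b k = 0) = S := by
        ext k
        simp only [hb, Finset.mem_filter]
        constructor
        · rintro ⟨-, h⟩
          by_contra hk
          simp [hk] at h
        · exact fun h => ⟨hS h, by simp [h]⟩
      rw [Finset.prod_congr rfl fun k hk => by
        rw [Function.update_of_ne (Finset.ne_of_mem_erase hk)], prod_actionGF, hfilter, hScard,
        card_erase_erase hij]
    simp only [hprod, add_lt_add_iff_right, weightedSum_indicator_gt]
    rw [← Finset.sum_mul, sum_perturbW_two, one_mul]

end

/-- For every `n ≥ 2` and `δ ∈ (0,1)`, `λ(n,2,δ) = (1-δ)·M(n-2,δ)`. -/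
theorem lipschitz_constant_two_actions_eq_M (n : ℕ) (hn : 2 ≤ n)
    (δ : ℝ) (hδ : δ ∈ Set.Ioo (0 : ℝ) 1) :
    lam n 2 δ = (1 - δ) * Mmax (n - 2) δ := by
  have h0 := hδ.1.le
  have h1 := hδ.2.le
  refine le_antisymm (csSup_le ⟨_, _, isGame_thresholdGame n 0, isAnonymous_thresholdGame n 0, rfl⟩
    ?_) ?_
  · rintro x ⟨g, hg, ha, rfl⟩
    exact lipC_perturbGame_two_le hn h0 h1 hg ha
  · obtain ⟨l, hl, s, hM⟩ := exists_Mmax_eq_coeff (n - 2) δ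
    obtain ⟨i, a, b, hi, hab, hval⟩ := exists_perturbGame_thresholdGame_sub hn δ hl s
    have hg := isGame_thresholdGame n s
    have ha := isAnonymous_thresholdGame n s
    calc (1 - δ) * Mmax (n - 2) δ
        ≤ |perturbGame n 2 δ (thresholdGame n s) a i -
            perturbGame n 2 δ (thresholdGame n s) b i| := by
          rw [hM, ← hval]
          exact le_abs_self _
      _ ≤ lipC n 2 (perturbGame n 2 δ (thresholdGame n s)) := by
          refine le_csSup ⟨(1 - δ) * Mmax (n - 2) δ, ?_⟩ ⟨i, a, b, hi, hab, rfl⟩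
          rintro x ⟨i', a', b', hi', hab', rfl⟩
          exact abs_perturbGame_two_sub_le_of_card_eq_one h0 h1 hg ha hi' hab'
      _ ≤ lam n 2 δ := by
          refine le_csSup ⟨(1 - δ) * Mmax (n - 2) δ, ?_⟩ ⟨_, hg, ha, rfl⟩
          rintro x ⟨g', hg', ha', rfl⟩
          exact lipC_perturbGame_two_le hn h0 h1 hg' ha'
end

section
/- There exists a global constant C > 0 such that for every n ≥ 1, every 0 < r ≤ 1/2, and every t ∈ {0,1}, setting η = 2πnr, one has |P(S_n^r = t) - η^{-1/2}| ≤ C/η, where (S_m^r) is the lazy symmetric random walk on ℤ with rate r. -/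
open MeasureTheory Real in
/-- Fourier inversion for the point probabilities of the lazy symmetric random walk. -/
lemma walk_eq_integral (r : ℝ) (n : ℕ) (z : ℤ) :
    walk r n z = (2 * π)⁻¹ * ∫ θ in (-π)..π, (1 - r * (1 - cos θ)) ^ n * cos (z * θ) := by
  induction n generalizing z with
  | zero =>
    by_cases hz : z = 0
    · subst hz
      simp only [walk, if_true, pow_zero, Int.cast_zero, zero_mul, cos_zero, mul_one,
        intervalIntegral.integral_const, smul_eq_mul]
      field_simp
      ring
    · have hz' : (z : ℝ) ≠ 0 := by exact_mod_cast hz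
      simp [walk, hz, intervalIntegral.integral_comp_mul_left (fun x => cos x) hz',
        sin_int_mul_pi]
  | succ n ih =>
    have hint : ∀ w : ℤ, IntervalIntegrable
        (fun θ => (1 - r * (1 - cos θ)) ^ n * cos (w * θ)) volume (-π) π := fun w =>
      Continuous.intervalIntegrable (by fun_prop) _ _
    have hsplit : (∫ θ in (-π)..π, (1 - r * (1 - cos θ)) ^ (n + 1) * cos (z * θ)) =
        ∫ θ in (-π)..π, ((1 - r) * ((1 - r * (1 - cos θ)) ^ n * cos (z * θ))
          + r / 2 * ((1 - r * (1 - cos θ)) ^ n * cos ((z - 1 : ℤ) * θ))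
          + r / 2 * ((1 - r * (1 - cos θ)) ^ n * cos ((z + 1 : ℤ) * θ))) := by
      congr 1
      ext θ
      push_cast
      rw [sub_mul (z : ℝ), add_mul (z : ℝ), one_mul, cos_sub, cos_add]
      ring
    rw [hsplit, intervalIntegral.integral_add
        (((hint _).const_mul _).add ((hint _).const_mul _)) ((hint _).const_mul _),
      intervalIntegral.integral_add ((hint _).const_mul _) ((hint _).const_mul _)]
    simp only [intervalIntegral.integral_const_mul, walk, ih]
    ring

open Real in
lemma abs_one_sub_pow_sub_exp_le {y : ℝ} (h0 : 0 ≤ y) (h1 : y ≤ 1) (n : ℕ) :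
    |(1 - y) ^ n - exp (-(n * y))| ≤ n * y ^ 2 * exp (-(n * y)) := by
  have hexp : exp (-(n * y)) = exp (-y) ^ n := by rw [← exp_nat_mul]; ring_nf
  have hupper : (1 - y) ^ n ≤ exp (-(n * y)) := by
    rw [hexp]
    exact pow_le_pow_left₀ (by linarith) (one_sub_le_exp_neg y) n
  have hbase : exp (-y) * (1 - y ^ 2) ≤ 1 - y := by
    have h2 : exp (-y) * (1 + y) ≤ 1 := by
      calc exp (-y) * (1 + y) ≤ exp (-y) * exp y := by
            gcongr
            linarith [add_one_le_exp y]
        _ = 1 := by rw [← exp_add]; simp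
    nlinarith
  have hlower : exp (-(n * y)) * (1 - n * y ^ 2) ≤ (1 - y) ^ n := by
    have hb : 1 - n * y ^ 2 ≤ (1 - y ^ 2) ^ n := by
      have := one_add_mul_le_pow (a := -y ^ 2) (by nlinarith) n
      rw [← sub_eq_add_neg] at this
      linarith
    calc exp (-(n * y)) * (1 - n * y ^ 2) ≤ exp (-y) ^ n * (1 - y ^ 2) ^ n := by
          rw [hexp]; gcongr
      _ = (exp (-y) * (1 - y ^ 2)) ^ n := (mul_pow _ _ _).symm
      _ ≤ (1 - y) ^ n := pow_le_pow_left₀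
          (mul_nonneg (exp_pos _).le (by nlinarith)) hbase n
  rw [abs_le]
  constructor
  · linarith
  · have : 0 ≤ n * y ^ 2 * exp (-(n * y)) := by positivity
    linarith

open Real in
lemma mul_exp_neg_le_one (u : ℝ) : u * exp (-u) ≤ 1 :=
  (mul_exp_neg_le_exp_neg_one u).trans (exp_le_one_iff.2 (by norm_num))

open Real in
lemma sq_div_two_sub_one_sub_cos_le {θ : ℝ} (h : |θ| ≤ π) :
    θ ^ 2 / 2 - (1 - cos θ) ≤ |θ| ^ 3 / 2 := by
  have hcos : 1 - cos θ = 2 * sin (|θ| / 2) ^ 2 := by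
    have h2 := cos_sq' (|θ| / 2)
    have h3 := cos_two_mul (|θ| / 2)
    rw [mul_div_cancel₀ _ (two_ne_zero' ℝ), cos_abs] at h3
    linarith
  have hu : 0 ≤ |θ| / 2 := by positivity
  have hs0 : 0 ≤ sin (|θ| / 2) := sin_nonneg_of_nonneg_of_le_pi hu (by linarith [pi_pos])
  have hsu : sin (|θ| / 2) ≤ |θ| / 2 := sin_le hu
  have hdiff : |θ| / 2 - sin (|θ| / 2) ≤ (|θ| / 2) ^ 2 := by
    rcases le_total (|θ| / 2) 1 with h1 | h1
    · have := sin_ge_sub_cube hu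
      nlinarith [mul_nonneg (sq_nonneg (|θ| / 2)) (sub_nonneg.2 h1), sq_nonneg (|θ| / 2)]
    · nlinarith
  rw [hcos, ← sq_abs θ]
  nlinarith [mul_le_mul hdiff (add_le_add_right hsu (|θ| / 2)) (by positivity) (by positivity)]

open Real in
/-- Pointwise comparison of the Fourier integrand of the walk with the Gaussian. -/
lemma abs_indicator_sub_gaussian_le {n : ℕ} {r : ℝ} (hr : 0 < r) (hr2 : r ≤ 1 / 2)
    {t : ℝ} (ht : |t| ≤ 1) (θ : ℝ) :
    |(Set.Ioc (-π) π).indicator (fun θ => (1 - r * (1 - cos θ)) ^ n * cos (t * θ)) θ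
        - exp (-(n * r / 2) * θ ^ 2)|
      ≤ (2 + π ^ 2) * (|θ| * exp (-(n * r / π ^ 2) * θ ^ 2)) := by
  have hpi := pi_gt_three
  set L : ℝ := n * r with hL
  have hL0 : 0 ≤ L := by positivity
  set E := exp (-(L / π ^ 2) * θ ^ 2) with hE
  have hE0 : 0 < E := exp_pos _
  by_cases hθ : θ ∈ Set.Ioc (-π) π
  · rw [Set.indicator_of_mem hθ]
    have habs : |θ| ≤ π := abs_le.2 ⟨hθ.1.le, hθ.2⟩
    set x := 1 - cos θ with hx
    have hx0 : 0 ≤ x := sub_nonneg.2 (cos_le_one θ)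
    have hx2 : x ≤ 2 := by linarith [neg_one_le_cos θ]
    have hxu : x ≤ θ ^ 2 / 2 := by linarith [one_sub_sq_div_two_le_cos (x := θ)]
    have hxl : 2 * (θ ^ 2 / π ^ 2) ≤ x := by
      have := cos_le_one_sub_mul_cos_sq habs
      have h2 : 2 / π ^ 2 * θ ^ 2 = 2 * (θ ^ 2 / π ^ 2) := by ring
      linarith
    have hLx : exp (-(L * x) / 2) ≤ E := by
      apply exp_le_exp.2
      have : L * (2 * (θ ^ 2 / π ^ 2)) ≤ L * x := by gcongr
      have h2 : -(L / π ^ 2) * θ ^ 2 = -(L * (2 * (θ ^ 2 / π ^ 2))) / 2 := by ring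
      rw [h2]; linarith
    have hsq : exp (-(L * x)) = exp (-(L * x) / 2) * exp (-(L * x) / 2) := by
      rw [← exp_add]; ring_nf
    have hEE : exp (-(L * x)) ≤ E * E := by
      rw [hsq]; gcongr
    have hE1 : E ≤ 1 := by
      rw [hE, exp_le_one_iff, neg_mul, neg_nonpos]; positivity
    have hy0 : 0 ≤ r * x := by positivity
    have hy1 : r * x ≤ 1 := by nlinarith
    have hpowE : (1 - r * x) ^ n ≤ E := by
      calc (1 - r * x) ^ n ≤ exp (-(r * x)) ^ n :=
            pow_le_pow_left₀ (by linarith) (one_sub_le_exp_neg _) n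
        _ = exp (-(L * x)) := by rw [← exp_nat_mul, hL]; ring_nf
        _ ≤ E * E := hEE
        _ ≤ E := by nlinarith
    have hpow0 : 0 ≤ (1 - r * x) ^ n := pow_nonneg (by linarith) n
    have h1 : |(1 - r * x) ^ n * cos (t * θ) - (1 - r * x) ^ n| ≤ |θ| * E := by
      have hc : |cos (t * θ) - 1| ≤ |θ| := by
        have := abs_cos_sub_cos_le (t * θ) 0
        rw [cos_zero, sub_zero, abs_mul] at this
        exact this.trans (mul_le_of_le_one_left (abs_nonneg _) ht)
      calc _ = |cos (t * θ) - 1| * (1 - r * x) ^ n := by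
            rw [← abs_of_nonneg hpow0, ← abs_mul, abs_of_nonneg hpow0]; ring_nf
        _ ≤ |θ| * E := by gcongr
    have h2 : |(1 - r * x) ^ n - exp (-(L * x))| ≤ |θ| * E := by
      have h := abs_one_sub_pow_sub_exp_le hy0 hy1 n
      have e1 : (n : ℝ) * (r * x) = L * x := by rw [hL]; ring
      have e2 : (n : ℝ) * (r * x) ^ 2 = (L * x) * (r * x) := by rw [hL]; ring
      rw [e1, e2, hsq] at h
      have hm : L * x / 2 * exp (-(L * x) / 2) ≤ 1 := by
        have := mul_exp_neg_le_one (L * x / 2)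
        rwa [← neg_div] at this
      have hrx : 2 * (r * x) ≤ |θ| := by
        have hlin : x ≤ |θ| := by
          have := abs_cos_sub_cos_le 0 θ
          rw [cos_zero, zero_sub, abs_neg] at this
          exact (le_abs_self _).trans this
        nlinarith
      rw [hsq]
      calc _ ≤ _ := h
        _ = (L * x / 2 * exp (-(L * x) / 2)) * (2 * (r * x)) * exp (-(L * x) / 2) := by ring
        _ ≤ 1 * |θ| * E := by gcongr
        _ = |θ| * E := by ring
    have h3 : |exp (-(L * x)) - exp (-(L / 2) * θ ^ 2)| ≤ π ^ 2 * (|θ| * E) := by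
      have hle : exp (-(L / 2) * θ ^ 2) ≤ exp (-(L * x)) := by
        apply exp_le_exp.2
        nlinarith
      rw [abs_of_nonneg (sub_nonneg.2 hle)]
      set d := θ ^ 2 / 2 - x with hd
      have hd3 : d ≤ |θ| ^ 3 / 2 := sq_div_two_sub_one_sub_cos_le habs
      have hfac : exp (-(L / 2) * θ ^ 2) = exp (-(L * x)) * exp (-(L * d)) := by
        rw [← exp_add, hd]; ring_nf
      have hm : L / π ^ 2 * θ ^ 2 * E ≤ 1 := by
        have := mul_exp_neg_le_one (L / π ^ 2 * θ ^ 2)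
        rwa [← neg_mul] at this
      calc exp (-(L * x)) - exp (-(L / 2) * θ ^ 2)
          = exp (-(L * x)) * (1 - exp (-(L * d))) := by rw [hfac]; ring
        _ ≤ exp (-(L * x)) * (L * d) := by
            gcongr
            linarith [one_sub_le_exp_neg (L * d)]
        _ ≤ (E * E) * (L * (|θ| ^ 3 / 2)) := by
            have : 0 ≤ d := by rw [hd]; linarith
            gcongr
        _ = (L / π ^ 2 * θ ^ 2 * E) * (π ^ 2 / 2 * (|θ| * E)) := by
            rw [← sq_abs θ]; field_simp
        _ ≤ 1 * (π ^ 2 / 2 * (|θ| * E)) := by gcongr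
        _ ≤ π ^ 2 * (|θ| * E) := by
            have : 0 ≤ π ^ 2 * (|θ| * E) := by positivity
            linarith
    calc _ ≤ _ := (abs_sub_le _ ((1 - r * x) ^ n) _).trans
          (add_le_add_right (abs_sub_le _ (exp (-(L * x))) _) _)
      _ ≤ |θ| * E + (|θ| * E + π ^ 2 * (|θ| * E)) := by gcongr
      _ = _ := by ring
  · rw [Set.indicator_of_notMem hθ, zero_sub, abs_neg, abs_of_pos (exp_pos _)]
    have habs : 1 ≤ |θ| := by
      by_contra! h
      rw [abs_lt] at h
      exact hθ ⟨by linarith, by linarith⟩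
    have hle : exp (-(L / 2) * θ ^ 2) ≤ E := by
      apply exp_le_exp.2
      have : L / π ^ 2 ≤ L / 2 := by
        gcongr
        nlinarith
      nlinarith [sq_nonneg θ]
    calc _ ≤ 1 * (1 * E) := by simpa using hle
      _ ≤ (2 + π ^ 2) * (|θ| * E) := by
          gcongr
          nlinarith

open MeasureTheory Real in
lemma integrable_abs_mul_exp_neg_mul_sq {b : ℝ} (hb : 0 < b) :
    Integrable fun x : ℝ => |x| * exp (-b * x ^ 2) := by
  simpa [abs_mul] using (integrable_mul_exp_neg_mul_sq hb).abs

open MeasureTheory Real in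
lemma integral_abs_mul_exp_neg_mul_sq {b : ℝ} (hb : 0 < b) :
    ∫ x : ℝ, |x| * exp (-b * x ^ 2) = b⁻¹ := by
  have h := integral_comp_abs (f := fun x : ℝ => x * exp (-b * x ^ 2))
  have h2 := integral_rpow_mul_exp_neg_mul_rpow (p := 2) (q := 1) two_pos (by norm_num) hb
  simp only [sq_abs] at h
  simp only [rpow_one, rpow_two] at h2
  rw [h, h2]
  norm_num [rpow_neg_one]
  ring

open MeasureTheory Real in
/-- There is a global constant `C > 0` such that for every `n ≥ 1`, `0 < r ≤ 1/2`
and `t ∈ {0,1}`, with `η = 2πnr`, `|P(S_n^r = t) - η^{-1/2}| ≤ C/η`. -/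
theorem walk_point_prob_asymptotics :
    ∃ C : ℝ, 0 < C ∧ ∀ (n : ℕ) (r : ℝ), 1 ≤ n → 0 < r → r ≤ 1 / 2 →
      ∀ t ∈ ({0, 1} : Set ℤ),
        |walk r n t - (Real.sqrt (2 * Real.pi * n * r))⁻¹|
          ≤ C / (2 * Real.pi * n * r) := by
  refine ⟨(2 + π ^ 2) * π ^ 2, by positivity, fun n r hn hr hr2 t ht => ?_⟩
  have hn0 : (0 : ℝ) < n := by exact_mod_cast hn
  have ht1 : |(t : ℝ)| ≤ 1 := by
    rcases ht with rfl | rfl <;> simp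
  set f : ℝ → ℝ := fun θ => (1 - r * (1 - cos θ)) ^ n * cos (t * θ) with hf
  have hfint : Integrable ((Set.Ioc (-π) π).indicator f) := by
    rw [integrable_indicator_iff measurableSet_Ioc]
    have hc : Continuous f := by fun_prop
    exact (hc.integrableOn_Icc).mono_set Set.Ioc_subset_Icc_self
  have hgint : Integrable fun θ : ℝ => exp (-(n * r / 2) * θ ^ 2) :=
    integrable_exp_neg_mul_sq (by positivity)
  have hb : (0 : ℝ) < n * r / π ^ 2 := by positivity
  have hgauss : (2 * π)⁻¹ * √(π / (n * r / 2)) = (√(2 * π * n * r))⁻¹ := by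
    have h1 : π / (n * r / 2) = (2 * π) ^ 2 / (2 * π * n * r) := by
      field_simp
    rw [h1, sqrt_div (by positivity), sqrt_sq (by positivity)]
    field_simp
  have hkey : walk r n t - (√(2 * π * n * r))⁻¹ =
      (2 * π)⁻¹ * ∫ θ, ((Set.Ioc (-π) π).indicator f θ - exp (-(n * r / 2) * θ ^ 2)) := by
    rw [integral_sub hfint hgint, integral_gaussian, integral_indicator measurableSet_Ioc,
      mul_sub, hgauss, walk_eq_integral,
      intervalIntegral.integral_of_le (by linarith [pi_pos])]
  have hbound : |∫ θ, ((Set.Ioc (-π) π).indicator f θ - exp (-(n * r / 2) * θ ^ 2))| ≤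
      (2 + π ^ 2) * (n * r / π ^ 2)⁻¹ := by
    rw [← integral_abs_mul_exp_neg_mul_sq hb, ← integral_const_mul, ← norm_eq_abs]
    refine norm_integral_le_of_norm_le
      ((integrable_abs_mul_exp_neg_mul_sq hb).const_mul _) (ae_of_all _ fun θ => ?_)
    exact abs_indicator_sub_gaussian_le hr hr2 ht1 θ
  rw [hkey, abs_mul, abs_of_pos (by positivity : (0 : ℝ) < (2 * π)⁻¹)]
  calc _ ≤ (2 * π)⁻¹ * ((2 + π ^ 2) * (n * r / π ^ 2)⁻¹) := by gcongr
    _ = _ := by field_simp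
end
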